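/- Suppose K is β_K-strongly convex. Let f : ℝ^d → ℝ be differentiable, convex on K and α-smooth on K, and let x⋆ ∈ K be a minimizer of f over K. Let x ∈ K, let v ∈ K be a linear-optimization step at x for f, let σ_t ∈ [0,1] be a line-search step size at (x, v) for f, and set x' = (1−σ_t)x + σ_t v. Then f(x') − f(x⋆) ≤ max{1 − β_K‖∇f(x)‖/(8α), 1/2} · (f(x) − f(x⋆)). -/

import Mathlib

open RealInnerProductSpace

/-- First-order lower bound for a convex function at a point of differentiability. -/
theorem ConvexOn.add_inner_gradient_le {E : Type*} [NormedAddCommGroup E]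
    [InnerProductSpace ℝ E] [CompleteSpace E] {K : Set E} {f : E → ℝ} (hf : ConvexOn ℝ K f)
    {x y : E} (hx : x ∈ K) (hy : y ∈ K) (hd : DifferentiableAt ℝ f x) :
    f x + ⟪gradient f x, y - x⟫ ≤ f y := by
  have hconv := hf.comp_affineMap (AffineMap.lineMap x y : ℝ →ᵃ[ℝ] E)
  have hderiv : HasDerivAt (f ∘ (AffineMap.lineMap x y : ℝ →ᵃ[ℝ] E))
      ⟪gradient f x, y - x⟫ 0 := by
    have hfx : HasFDerivAt f (InnerProductSpace.toDual ℝ E (gradient f x))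
        ((AffineMap.lineMap x y : ℝ →ᵃ[ℝ] E) 0) := by
      simpa using hd.hasGradientAt.hasFDerivAt
    simpa using hfx.comp_hasDerivAt (0 : ℝ) AffineMap.hasDerivAt_lineMap
  have h := hconv.le_slope_of_hasDerivAt (x := 0) (y := 1) (by simpa using hx)
    (by simpa using hy) one_pos hderiv
  simp only [slope_def_field, Function.comp_apply, AffineMap.lineMap_apply_zero,
    AffineMap.lineMap_apply_one, sub_zero, div_one] at h
  linarith

/-- Over a strongly convex set, the Frank-Wolfe gap dominates the squared distance to the
linear-optimization step. -/
theorem mul_norm_mul_sq_le_inner_of_strongly_convex_set {E : Type*} [NormedAddCommGroup E]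
    [InnerProductSpace ℝ E] {K : Set E} {β : ℝ}
    (hK : ∀ x ∈ K, ∀ y ∈ K, ∀ γ ∈ Set.Icc (0 : ℝ) 1, ∀ z : E, ‖z‖ = 1 →
      γ • x + (1 - γ) • y + (γ * (1 - γ) * (β / 2) * ‖x - y‖ ^ 2) • z ∈ K)
    {g x v : E} (hx : x ∈ K) (hv : v ∈ K) (hmin : ∀ u ∈ K, ⟪g, v⟫ ≤ ⟪g, u⟫) :
    β / 4 * ‖g‖ * ‖x - v‖ ^ 2 ≤ ⟪g, x - v⟫ := by
  rcases eq_or_ne g 0 with rfl | hg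
  · simp
  have hg' : ‖g‖ ≠ 0 := norm_ne_zero_iff.mpr hg
  have hunit : ‖-(‖g‖⁻¹ • g)‖ = 1 := by
    rw [norm_neg, norm_smul, norm_inv, norm_norm, inv_mul_cancel₀ hg']
  have hinner : ⟪g, -(‖g‖⁻¹ • g)⟫ = -‖g‖ := by
    rw [inner_neg_right, real_inner_smul_right, real_inner_self_eq_norm_sq]
    field_simp
  have h := hmin _ (hK x hx v hv (1 / 2) (by norm_num) _ hunit)
  rw [inner_add_right, inner_add_right, real_inner_smul_right, real_inner_smul_right,
    real_inner_smul_right, hinner] at h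
  rw [inner_sub_right]
  linarith

/-- one FW line-search step over a strongly convex set contracts
the optimality gap. -/
theorem fw_line_search_step_strongly_convex_set
    {d : ℕ} {K : Set (EuclideanSpace ℝ (Fin d))}
    (hKne : K.Nonempty) (hKconv : Convex ℝ K)
    {βK : ℝ} (hβK : 0 < βK)
    (hKsc : ∀ x ∈ K, ∀ y ∈ K, ∀ γ ∈ Set.Icc (0 : ℝ) 1,
      ∀ z : EuclideanSpace ℝ (Fin d), ‖z‖ = 1 →
        γ • x + (1 - γ) • y + (γ * (1 - γ) * (βK / 2) * ‖x - y‖ ^ 2) • z ∈ K)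
    {α : ℝ} (hα : 0 < α)
    {f : EuclideanSpace ℝ (Fin d) → ℝ}
    (hfdiff : Differentiable ℝ f)
    (hfconv : ConvexOn ℝ K f)
    (hfsmooth : ∀ x ∈ K, ∀ y ∈ K,
      f y ≤ f x + ⟪gradient f x, y - x⟫ + α / 2 * ‖x - y‖ ^ 2)
    {xstar : EuclideanSpace ℝ (Fin d)}
    (hxstarK : xstar ∈ K) (hxstar : ∀ u ∈ K, f xstar ≤ f u)
    {x v : EuclideanSpace ℝ (Fin d)} (hxK : x ∈ K) (hvK : v ∈ K)
    (hv : ∀ u ∈ K, ⟪gradient f x, v⟫ ≤ ⟪gradient f x, u⟫)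
    {σt : ℝ} (hσt : σt ∈ Set.Icc (0 : ℝ) 1)
    (hls : ∀ σ' ∈ Set.Icc (0 : ℝ) 1,
      σt * ⟪gradient f x, v - x⟫ + α * σt ^ 2 / 2 * ‖x - v‖ ^ 2 ≤
        σ' * ⟪gradient f x, v - x⟫ + α * σ' ^ 2 / 2 * ‖x - v‖ ^ 2)
    {x' : EuclideanSpace ℝ (Fin d)} (hx' : x' = (1 - σt) • x + σt • v) :
    f x' - f xstar ≤
      max (1 - βK * ‖gradient f x‖ / (8 * α)) (1 / 2) * (f x - f xstar) := by
  have hxx' : x - x' = σt • (x - v) := by rw [hx']; module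
  have hx'x : x' - x = σt • (v - x) := by rw [hx']; module
  have hx'K : x' ∈ K := by
    rw [hx']
    exact hKconv hxK hvK (by linarith [hσt.2]) hσt.1 (by ring)
  have hdesc := hfsmooth x hxK x' hx'K
  rw [hxx', hx'x, real_inner_smul_right, norm_smul, mul_pow, Real.norm_eq_abs, sq_abs] at hdesc
  have hfirst := hfconv.add_inner_gradient_le hxK hxstarK (hfdiff x)
  have hlin := hv xstar hxstarK
  have hgap := mul_norm_mul_sq_le_inner_of_strongly_convex_set hKsc hxK hvK hv
  have hopt := hxstar x hxK
  simp only [inner_sub_right] at hdesc hfirst hgap hls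
  set G := ⟪gradient f x, x⟫ - ⟪gradient f x, v⟫
  have hprimal : f x - f xstar ≤ G := by linarith
  have hstep : ∀ s ∈ Set.Icc (0 : ℝ) 1,
      f x' ≤ f x - s * G + α * s ^ 2 / 2 * ‖x - v‖ ^ 2 := by
    intro s hs
    linarith [hls s hs]
  rcases le_total (βK * ‖gradient f x‖) (4 * α) with hcase | hcase
  · set s := βK * ‖gradient f x‖ / (4 * α) with hs
    have hs0 : 0 ≤ s := by positivity
    have hs1 : s ≤ 1 := (div_le_one (by positivity)).mpr hcase
    have hαs : α * s = βK / 4 * ‖gradient f x‖ := by rw [hs]; field_simp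
    rw [← hαs] at hgap
    have hrate : βK * ‖gradient f x‖ / (8 * α) = s / 2 := by rw [hs]; field_simp; ring
    rw [hrate]
    calc f x' - f xstar ≤ (1 - s / 2) * (f x - f xstar) := by
          linarith [hstep s ⟨hs0, hs1⟩, mul_le_mul_of_nonneg_left hgap hs0,
            mul_le_mul_of_nonneg_left hprimal hs0]
      _ ≤ _ := mul_le_mul_of_nonneg_right (le_max_left _ _) (by linarith)
  · have hD : α * ‖x - v‖ ^ 2 ≤ G :=
      (mul_le_mul_of_nonneg_right (by linarith) (sq_nonneg _)).trans hgap
    calc f x' - f xstar ≤ 1 / 2 * (f x - f xstar) := by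
          linarith [hstep 1 (by norm_num)]
      _ ≤ _ := mul_le_mul_of_nonneg_right (le_max_right _ _) (by linarith)
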